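/- Let (Σ,σ) be a topologically transitive countable Markov shift with finite topological entropy h_top < ∞, and let φ : Σ → ℝ be a bounded potential with summable variations. If h_∞ < h_top and sup φ − inf φ < h_top − h_∞, then δ_{φ,∞} + h_∞ < P(φ); in particular (CI) holds and φ is strongly positive recurrent. -/

import Mathlib

open Filter Set MeasureTheory Real ENNReal

namespace CMS

/-- Points of the full sequence space over the alphabet `ℕ`. -/
abbrev Pt : Type := ℕ → ℕ

/-- The (left) shift map `σ`. -/
def shiftMap : Pt → Pt := fun x i => x (i + 1)

/-- `x` is a point of the countable Markov shift `Σ` determined by the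
transition matrix `M` (identified with a relation on the alphabet `ℕ`). -/
def isAdmissible (M : ℕ → ℕ → Prop) (x : Pt) : Prop := ∀ i, M (x i) (x (i + 1))

/-- Topological transitivity: for all states `a, b` there is `N` with
`[a] ∩ σ⁻ᴺ [b] ≠ ∅`. -/
def TopTransitive (M : ℕ → ℕ → Prop) : Prop :=
  ∀ a b : ℕ, ∃ (N : ℕ) (x : Pt), isAdmissible M x ∧ x 0 = a ∧ x N = b

/-- Birkhoff sum `S_n φ`. -/
noncomputable def birkhoff (φ : Pt → ℝ) (n : ℕ) (x : Pt) : ℝ :=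
  ∑ i ∈ Finset.range n, φ (shiftMap^[i] x)

/-- `φ` has summable variations: `∑_{k ≥ 2} var_k(φ) < ∞`, expressed via a summable
sequence dominating the `k`-th variations. -/
def SummableVariations (M : ℕ → ℕ → Prop) (φ : Pt → ℝ) : Prop :=
  ∃ V : ℕ → ℝ, Summable V ∧
    ∀ k, 2 ≤ k → ∀ x y : Pt, isAdmissible M x → isAdmissible M y →
      (∀ i < k, x i = y i) → |φ x - φ y| ≤ V k

/-- `φ` is weakly Hölder continuous: `var_k(φ) ≤ C θ^k` for all `k ≥ 2`. -/
def WeaklyHolder (M : ℕ → ℕ → Prop) (φ : Pt → ℝ) : Prop :=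
  ∃ C θ : ℝ, 0 < C ∧ 0 < θ ∧ θ < 1 ∧
    ∀ k, 2 ≤ k → ∀ x y : Pt, isAdmissible M x → isAdmissible M y →
      (∀ i < k, x i = y i) → |φ x - φ y| ≤ C * θ ^ k

/-- Periodic points of period `n` in the 1-cylinder `[a]`. -/
def PerSet (M : ℕ → ℕ → Prop) (a n : ℕ) : Set Pt :=
  {x | isAdmissible M x ∧ shiftMap^[n] x = x ∧ x 0 = a}

/-- Periodic points of period `n` in `[a]` whose first return time to `[a]` is `n`. -/
def PerStarSet (M : ℕ → ℕ → Prop) (a n : ℕ) : Set Pt :=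
  {x | isAdmissible M x ∧ shiftMap^[n] x = x ∧ x 0 = a ∧ ∀ k, 0 < k → k < n → x k ≠ a}

/-- The Gurevich partition function `Z_n(φ, a)`. -/
noncomputable def Zn (M : ℕ → ℕ → Prop) (φ : Pt → ℝ) (a n : ℕ) : ℝ≥0∞ :=
  ∑' x : PerSet M a n, ENNReal.ofReal (Real.exp (birkhoff φ n x.1))

/-- The first-return partition function `Z_n^*(φ, a)`. -/
noncomputable def ZnStar (M : ℕ → ℕ → Prop) (φ : Pt → ℝ) (a n : ℕ) : ℝ≥0∞ :=
  ∑' x : PerStarSet M a n, ENNReal.ofReal (Real.exp (birkhoff φ n x.1))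

/-- The Gurevich pressure at the state `a`:
`P(φ) = limsup_n (1/n) log Z_n(φ, a)`, with values in `EReal`. -/
noncomputable def pressureAt (M : ℕ → ℕ → Prop) (φ : Pt → ℝ) (a : ℕ) : EReal :=
  Filter.limsup (fun n : ℕ => ((n : ℝ)⁻¹ : EReal) * ENNReal.log (Zn M φ a n)) atTop

/-- `limsup_n (1/n) log Z_n^*(φ, a)`, with values in `EReal`. -/
noncomputable def pressureStarAt (M : ℕ → ℕ → Prop) (φ : Pt → ℝ) (a : ℕ) : EReal :=
  Filter.limsup (fun n : ℕ => ((n : ℝ)⁻¹ : EReal) * ENNReal.log (ZnStar M φ a n)) atTop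

/-- Strong positive recurrence of `φ`, relative to the common value `P` of the
Gurevich pressure: for some state `a`, `limsup_n (1/n) log Z_n^*(φ,a) < P(φ)`. -/
def SPR (M : ℕ → ℕ → Prop) (φ : Pt → ℝ) (P : ℝ) : Prop :=
  ∃ a : ℕ, pressureStarAt M φ a < (P : EReal)

/-- The `F`-property: for every state `a` and every `n ≥ 1` there are only finitely
many periodic points of period `n` in `[a]`. -/
def FProperty (M : ℕ → ℕ → Prop) : Prop :=
  ∀ a n : ℕ, 0 < n → (PerSet M a n).Finite

/-- `χ_per(φ) = sup { (1/n) S_n φ(x) : σ^n x = x, n ∈ ℕ }`, with values in `EReal`. -/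
noncomputable def chiPer (M : ℕ → ℕ → Prop) (φ : Pt → ℝ) : EReal :=
  ⨆ p : {p : Pt × ℕ // isAdmissible M p.1 ∧ 0 < p.2 ∧ shiftMap^[p.2] p.1 = p.1},
    ((birkhoff φ p.1.2 p.1.1 / (p.1.2 : ℝ) : ℝ) : EReal)

/-- `x` lies in a cylinder belonging to `B(n, M', q)`: it is admissible,
`x 0 ≤ q`, `x n ≤ q` and `#{0 ≤ k ≤ n : x k ≤ q} ≤ (n+1)/M'`. -/
def inBSet (M : ℕ → ℕ → Prop) (n M' q : ℕ) (x : Pt) : Prop :=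
  isAdmissible M x ∧ x 0 ≤ q ∧ x n ≤ q ∧
    ((((Finset.range (n + 1)).filter (fun k => x k ≤ q)).card : ℝ) ≤ (n + 1 : ℝ) / (M' : ℝ))

/-- `z_{φ,n}(M',q) = sup { (1/n) S_n φ(x) : x ∈ B for some B ∈ B(n,M',q) }`. -/
noncomputable def zPhi (M : ℕ → ℕ → Prop) (φ : Pt → ℝ) (n M' q : ℕ) : EReal :=
  ⨆ x : {x : Pt // inBSet M n M' q x}, ((birkhoff φ n x.1 / (n : ℝ) : ℝ) : EReal)

/-- The contraction at infinity
`δ_{φ,∞} = lim_{q→∞} lim_{M'→∞} limsup_{n→∞} z_{φ,n}(M',q)`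
(the inner limits exist by monotonicity, so they agree with `liminf`s). -/
noncomputable def deltaInf (M : ℕ → ℕ → Prop) (φ : Pt → ℝ) : EReal :=
  liminf (fun q : ℕ => liminf (fun M' : ℕ =>
    limsup (fun n : ℕ => zPhi M φ n M' q) atTop) atTop) atTop

/-- `z_n(M',q) = #B(n,M',q)`, the number of `(n+1)`-cylinders (i.e. admissible
words realized in `Σ`) in `B(n,M',q)`, counted in `ℝ≥0∞`. -/
noncomputable def zCount (M : ℕ → ℕ → Prop) (n M' q : ℕ) : ℝ≥0∞ :=
  ∑' _w : {w : Fin (n + 1) → ℕ //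
      (∃ x : Pt, isAdmissible M x ∧ ∀ i : Fin (n + 1), x (i : ℕ) = w i) ∧
      w 0 ≤ q ∧ w (Fin.last n) ≤ q ∧
      (((Finset.univ.filter (fun i : Fin (n + 1) => w i ≤ q)).card : ℝ) ≤ (n + 1 : ℝ) / (M' : ℝ))},
    (1 : ℝ≥0∞)

/-- The entropy at infinity
`h_∞ = lim_{q→∞} lim_{M'→∞} limsup_{n→∞} (1/n) log z_n(M',q)`. -/
noncomputable def hInfty (M : ℕ → ℕ → Prop) : EReal :=
  liminf (fun q : ℕ => liminf (fun M' : ℕ =>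
    limsup (fun n : ℕ => ((n : ℝ)⁻¹ : EReal) * ENNReal.log (zCount M n M' q)) atTop) atTop) atTop

end CMS

open CMS

namespace CMS

lemma shiftMap_iterate_apply (k : ℕ) (x : Pt) (i : ℕ) : shiftMap^[k] x i = x (i + k) := by
  induction k generalizing x with
  | zero => rfl
  | succ k ih => rw [Function.iterate_succ_apply, ih]; simp only [shiftMap]; congr 1

lemma isAdmissible.iterate {M : ℕ → ℕ → Prop} {x : Pt} (hx : isAdmissible M x) (k : ℕ) :
    isAdmissible M (shiftMap^[k] x) := by
  intro i
  rw [shiftMap_iterate_apply, shiftMap_iterate_apply]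
  have := hx (i + k)
  rwa [show i + k + 1 = i + 1 + k by omega] at this

lemma birkhoff_add (φ : Pt → ℝ) (m n : ℕ) (x : Pt) :
    birkhoff φ (m + n) x = birkhoff φ m x + birkhoff φ n (shiftMap^[m] x) := by
  simp only [birkhoff, Finset.sum_range_add, ← Function.iterate_add_apply]
  simp only [Nat.add_comm]

lemma birkhoff_succ (φ : Pt → ℝ) (n : ℕ) (x : Pt) :
    birkhoff φ (n + 1) x = φ x + birkhoff φ n (shiftMap x) := by
  rw [Nat.add_comm, birkhoff_add]; simp [birkhoff]

lemma birkhoff_le {M : ℕ → ℕ → Prop} {φ : Pt → ℝ} {s : ℝ}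
    (h : ∀ x, isAdmissible M x → φ x ≤ s) (n : ℕ) {x : Pt} (hx : isAdmissible M x) :
    birkhoff φ n x ≤ n * s := by
  have := Finset.sum_le_sum (s := Finset.range n) fun i _ => h _ (hx.iterate i)
  simpa [birkhoff] using this

lemma le_birkhoff {M : ℕ → ℕ → Prop} {φ : Pt → ℝ} {s : ℝ}
    (h : ∀ x, isAdmissible M x → s ≤ φ x) (n : ℕ) {x : Pt} (hx : isAdmissible M x) :
    n * s ≤ birkhoff φ n x := by
  have := Finset.sum_le_sum (s := Finset.range n) fun i _ => h _ (hx.iterate i)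
  simpa [birkhoff] using this

/-- The word formed by the first `n` symbols of `x`. -/
def word : ℕ → Pt → List ℕ
  | 0, _ => []
  | n + 1, x => x 0 :: word n (shiftMap x)

/-- The point obtained by writing the word `l` in front of `t`. -/
def app : List ℕ → Pt → Pt
  | [], t => t
  | c :: l, t => fun i => Nat.casesOn i c (app l t)

/-- The periodic point obtained by repeating the word `l`. -/
def per (l : List ℕ) : Pt := fun i => l.getD (i % l.length) 0

@[simp] lemma length_word (n : ℕ) (x : Pt) : (word n x).length = n := by
  induction n generalizing x with
  | zero => rfl
  | succ n ih => simp [word, ih]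

@[simp] lemma shiftMap_app_cons (c : ℕ) (l : List ℕ) (t : Pt) :
    shiftMap (app (c :: l) t) = app l t := rfl

lemma app_append (l l' : List ℕ) (t : Pt) : app (l ++ l') t = app l (app l' t) := by
  induction l with
  | nil => rfl
  | cons c l ih => simp [app, ih]

lemma shiftMap_iterate_app (l : List ℕ) (t : Pt) : shiftMap^[l.length] (app l t) = t := by
  induction l with
  | nil => rfl
  | cons c l ih => rw [List.length_cons, Function.iterate_succ_apply, shiftMap_app_cons, ih]

lemma app_word (n : ℕ) (x : Pt) : app (word n x) (shiftMap^[n] x) = x := by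
  induction n generalizing x with
  | zero => rfl
  | succ n ih =>
    rw [Function.iterate_succ_apply, word]
    funext i
    cases i with
    | zero => rfl
    | succ i => exact congrFun (ih (shiftMap x)) i

lemma word_app (l : List ℕ) (t : Pt) : word l.length (app l t) = l := by
  induction l with
  | nil => rfl
  | cons c l ih => rw [List.length_cons, word, shiftMap_app_cons, ih]; rfl

lemma word_succ (n : ℕ) (x : Pt) : word (n + 1) x = word n x ++ [x n] := by
  induction n generalizing x with
  | zero => rfl
  | succ n ih => rw [word, ih]; simp [word, shiftMap]

lemma mem_word {n : ℕ} {x : Pt} {c : ℕ} : c ∈ word n x ↔ ∃ k < n, x k = c := by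
  induction n with
  | zero => simp [word]
  | succ n ih =>
    rw [word_succ, List.mem_append, ih, List.mem_singleton]
    constructor
    · rintro (⟨k, hk, rfl⟩ | rfl)
      · exact ⟨k, by omega, rfl⟩
      · exact ⟨n, by omega, rfl⟩
    · rintro ⟨k, hk, rfl⟩
      rcases Nat.lt_succ_iff_lt_or_eq.1 hk with h | rfl
      · exact Or.inl ⟨k, h, rfl⟩
      · exact Or.inr rfl

lemma count_word (b n : ℕ) (x : Pt) :
    (word n x).count b = ((Finset.range n).filter (fun k => x k = b)).card := by
  induction n with
  | zero => rfl
  | succ n ih =>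
    rw [word_succ, List.count_append, ih, Finset.range_add_one, Finset.filter_insert]
    by_cases h : x n = b <;> simp [h]

lemma isChain_word {M : ℕ → ℕ → Prop} {x : Pt} (hx : isAdmissible M x) (n : ℕ) :
    (word n x).IsChain M := by
  induction n generalizing x with
  | zero => exact List.isChain_nil
  | succ n ih =>
    have h := ih (hx.iterate 1)
    cases n with
    | zero => exact List.isChain_singleton _
    | succ n => exact List.isChain_cons_cons.2 ⟨hx 0, h⟩

lemma app_apply (l : List ℕ) (t : Pt) (i : ℕ) :
    app l t i = if i < l.length then l.getD i 0 else t (i - l.length) := by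
  induction l generalizing i with
  | nil => simp [app]
  | cons c l ih =>
    cases i with
    | zero => simp [app]
    | succ i =>
      have : app (c :: l) t (i + 1) = app l t i := rfl
      rw [this, ih]; simp

lemma app_per (l : List ℕ) : app l (per l) = per l := by
  funext i
  rw [app_apply]
  split_ifs with h
  · rw [per, Nat.mod_eq_of_lt h]
  · rw [per, per, ← Nat.mod_eq_sub_mod (not_lt.1 h)]

lemma eq_of_app_eq {l : List ℕ} (hl : l ≠ []) {x y : Pt} (hx : app l x = x) (hy : app l y = y) :
    x = y := by
  have hl' := List.length_pos_iff.2 hl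
  funext i
  induction i using Nat.strong_induction_on with
  | _ i ih =>
    rw [← hx, ← hy, app_apply, app_apply]
    split_ifs with h
    · rfl
    · exact ih _ (by omega)

lemma word_per (l : List ℕ) : word l.length (per l) = l := by
  conv_lhs => rw [← app_per]
  exact word_app l _

lemma shiftMap_iterate_per (l : List ℕ) : shiftMap^[l.length] (per l) = per l := by
  conv_lhs => rw [← app_per]
  exact shiftMap_iterate_app l _

lemma isAdmissible_per {M : ℕ → ℕ → Prop} {a : ℕ} {u : List ℕ}
    (h : (a :: (u ++ [a])).IsChain M) : isAdmissible M (per (a :: u)) := by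
  intro i
  rw [List.isChain_iff_getElem] at h
  have hr : i % (u.length + 1) < u.length + 1 := Nat.mod_lt _ (by omega)
  have h1 := h (i % (u.length + 1)) (by simp; omega)
  have key : ∀ j (hj : j < (a :: (u ++ [a])).length),
      (a :: (u ++ [a]))[j] = (a :: u).getD (j % (u.length + 1)) 0 := by
    intro j hj
    simp only [List.length_cons, List.length_append, List.length_nil] at hj
    rcases Nat.lt_succ_iff_lt_or_eq.1 (show j < (u.length + 1) + 1 by omega) with h | rfl
    · rw [Nat.mod_eq_of_lt h]
      simp only [← List.cons_append]
      rw [List.getElem_append_left (by simpa using h)]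
      rw [List.getD_eq_getElem?_getD, List.getElem?_eq_getElem (by simpa using h)]; rfl
    · simp
  rw [key, key] at h1
  simpa [per] using h1

/-! ### Inserting loops into words -/

/-- The word underlying a decorated word, where the letter `none` stands for a marked `b`. -/
def base (b : ℕ) (d : List (Option ℕ)) : List ℕ := d.map (fun c => c.getD b)

/-- The word obtained from a decorated word by inserting the loop `b L b` at each marked `b`. -/
def expand (b : ℕ) (L : List ℕ) : List (Option ℕ) → List ℕ
  | [] => []
  | none :: d => b :: (L ++ b :: expand b L d)
  | some c :: d => c :: expand b L d

/-- The number of letters before the first mark. -/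
def lead : List (Option ℕ) → ℕ
  | [] => 0
  | none :: _ => 0
  | some _ :: d => lead d + 1

/-- All decorations of a word. -/
def decs (b : ℕ) : List ℕ → Finset (List (Option ℕ))
  | [] => {[]}
  | c :: w => (decs b w).image (fun d => some c :: d) ∪
      if c = b then (decs b w).image (fun d => none :: d) else ∅

lemma base_of_mem_decs {b : ℕ} {w : List ℕ} {d : List (Option ℕ)} (h : d ∈ decs b w) :
    base b d = w := by
  induction w generalizing d with
  | nil => simp [decs] at h; simp [h, base]
  | cons c w ih =>
    simp only [decs, Finset.mem_union, Finset.mem_image] at h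
    rcases h with ⟨e, he, rfl⟩ | h
    · simp [base, ← ih he]
    · split_ifs at h with hc
      · obtain ⟨e, he, rfl⟩ := Finset.mem_image.1 h
        simp [base, ← ih he, hc]
      · simp at h

lemma mem_of_some_mem_decs {b : ℕ} {w : List ℕ} {d : List (Option ℕ)} (h : d ∈ decs b w) {c : ℕ}
    (hc : some c ∈ d) : c ∈ w := by
  rw [← base_of_mem_decs h]
  exact List.mem_map.2 ⟨some c, hc, rfl⟩

lemma sum_decs (b : ℕ) (w : List ℕ) (κ : ℝ) :
    ∑ d ∈ decs b w, κ ^ d.count none = (1 + κ) ^ w.count b := by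
  induction w with
  | nil => simp [decs]
  | cons c w ih =>
    have h1 : ∀ o : Option ℕ, Function.Injective (fun d : List (Option ℕ) => o :: d) :=
      fun o => List.cons_injective
    rw [decs, Finset.sum_union]
    · rw [Finset.sum_image (fun _ _ _ _ h => h1 _ h)]
      split_ifs with hc
      · subst hc
        rw [Finset.sum_image (fun _ _ _ _ h => h1 _ h)]
        simp only [List.count_cons, beq_self_eq_true, if_true, pow_succ, ← Finset.sum_mul]
        simp [ih]; ring
      · simp [ih, hc]
    · rw [Finset.disjoint_left]
      intro d hd hd'
      obtain ⟨e, -, rfl⟩ := Finset.mem_image.1 hd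
      split_ifs at hd' <;> simp at hd'

lemma length_expand (b : ℕ) (L : List ℕ) (d : List (Option ℕ)) :
    (expand b L d).length = d.length + d.count none * (L.length + 1) := by
  induction d with
  | nil => simp [expand]
  | cons o d ih =>
    cases o with
    | none => simp [expand, ih]; ring
    | some c => simp [expand, ih]; ring

lemma isChain_expand {M : ℕ → ℕ → Prop} {b : ℕ} {L : List ℕ} (hL : (b :: (L ++ [b])).IsChain M)
    (d : List (Option ℕ)) (c z : ℕ) (h : (c :: (base b d ++ [z])).IsChain M) :
    (c :: (expand b L d ++ [z])).IsChain M := by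
  induction d generalizing c with
  | nil => exact h
  | cons o d ih =>
    cases o with
    | some e =>
      simp only [base, List.map_cons, List.cons_append, List.isChain_cons_cons] at h
      exact List.isChain_cons_cons.2 ⟨h.1, ih _ h.2⟩
    | none =>
      simp only [base, List.map_cons, List.cons_append, List.isChain_cons_cons] at h
      have h2 := ih _ h.2
      refine List.isChain_cons_cons.2 ⟨h.1, ?_⟩
      have := List.isChain_split (R := M) (c := b) (l₁ := b :: L) (l₂ := expand b L d ++ [z])
      simpa using this.2 ⟨by simpa using hL, h2⟩

lemma lt_idxOf_expand {a b : ℕ} {u v : List ℕ} (hab : a ≠ b) (hu : a ∉ u)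
    (d : List (Option ℕ)) (hd : some a ∉ d) (ha : a ∈ expand b (u ++ a :: v) d) :
    u.length < (expand b (u ++ a :: v) d).idxOf a := by
  induction d with
  | nil => simp [expand] at ha
  | cons o d ih =>
    cases o with
    | none =>
      rw [expand, List.idxOf_cons_ne _ hab.symm, List.append_assoc, List.idxOf_append_of_notMem hu]
      simp
    | some c =>
      simp only [List.mem_cons, Option.some.injEq, not_or] at hd
      simp only [expand, List.mem_cons, hd.1, false_or] at ha
      rw [expand, List.idxOf_cons_ne _ (Ne.symm hd.1)]
      have := ih hd.2 ha
      omega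

lemma expand_injOn {a b : ℕ} {u v : List ℕ} (hab : a ≠ b) (hu : a ∉ u)
    {d d' : List (Option ℕ)} (hd : some a ∉ d) (hd' : some a ∉ d')
    (h : expand b (u ++ a :: v) d = expand b (u ++ a :: v) d') : d = d' := by
  have aux : ∀ (e : List (Option ℕ)) (l : List ℕ), some a ∉ e →
      u ++ a :: v ++ l ≠ expand b (u ++ a :: v) e := by
    intro e l he h
    have h1 := lt_idxOf_expand (v := v) hab hu e he (by rw [← h]; simp)
    rw [← h, List.append_assoc, List.idxOf_append_of_notMem hu] at h1
    simp at h1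
  induction d generalizing d' with
  | nil =>
    cases d' with
    | nil => rfl
    | cons o d' => cases o <;> simp [expand] at h
  | cons o d ih =>
    simp only [List.mem_cons, not_or] at hd
    cases d' with
    | nil => cases o <;> simp [expand] at h
    | cons o' d' =>
      simp only [List.mem_cons, not_or] at hd'
      cases o with
      | none =>
        cases o' with
        | none =>
          simp only [expand, List.cons.injEq, true_and, List.append_cancel_left_eq] at h
          rw [ih hd.2 hd'.2 h]
        | some c =>
          simp only [expand, List.cons.injEq] at h
          exact absurd h.2 (aux _ _ hd'.2)
      | some c =>
        cases o' with
        | none =>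
          simp only [expand, List.cons.injEq] at h
          exact absurd h.2.symm (aux _ _ hd.2)
        | some c' =>
          simp only [expand, List.cons.injEq] at h
          rw [ih hd.2 hd'.2 h.2, h.1]

lemma app_base_eq_app_expand (b : ℕ) (L : List ℕ) (d : List (Option ℕ)) (t t' : Pt) (i : ℕ)
    (hi : i < lead d) : app (base b d) t i = app (expand b L d) t' i := by
  induction d generalizing i with
  | nil => simp [lead] at hi
  | cons o d ih =>
    cases o with
    | none => simp [lead] at hi
    | some c =>
      cases i with
      | zero => rfl
      | succ i => exact ih i (by simpa [lead] using hi)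

lemma birkhoff_base_le {M : ℕ → ℕ → Prop} {φ : Pt → ℝ} {B S : ℝ} {W : ℕ → ℝ}
    (hφ : ∀ x, isAdmissible M x → |φ x| ≤ B)
    (hW0 : ∀ k, 0 ≤ W k)
    (hW : ∀ k x y, isAdmissible M x → isAdmissible M y → (∀ i < k, x i = y i) → φ x - φ y ≤ W k)
    (hS : ∀ n, ∑ j ∈ Finset.range n, W j ≤ S) (b : ℕ) (L : List ℕ) (d : List (Option ℕ))
    (t t' : Pt) (hx : isAdmissible M (app (base b d) t))
    (hy : isAdmissible M (app (expand b L d) t')) :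
    birkhoff φ d.length (app (base b d) t) ≤
      birkhoff φ (expand b L d).length (app (expand b L d) t') +
        d.count none * (B * (L.length + 3) + S) + ∑ j ∈ Finset.range (lead d + 1), W j := by
  induction d with
  | nil => simpa [birkhoff, expand, lead] using hW0 0
  | cons o d ih =>
    cases o with
    | some c =>
      have ih := ih (hx.iterate 1) (hy.iterate 1)
      have h1 := hW _ _ _ hx hy (app_base_eq_app_expand b L (some c :: d) t t')
      have e1 : shiftMap (app (base b (some c :: d)) t) = app (base b d) t := rfl
      have e2 : shiftMap (app (expand b L (some c :: d)) t') = app (expand b L d) t' := rfl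
      have e3 : (expand b L (some c :: d)).length = (expand b L d).length + 1 := rfl
      rw [List.length_cons, birkhoff_succ, e3, birkhoff_succ, e1, e2, lead, Finset.sum_range_succ]
      simp only [lead] at h1
      simp only [List.count_cons, reduceCtorEq, beq_iff_eq, if_false, add_zero]
      linarith
    | none =>
      have e0 : expand b L (none :: d) = (b :: (L ++ [b])) ++ expand b L d := by simp [expand]
      rw [e0, app_append] at hy
      have e2 := shiftMap_iterate_app (b :: (L ++ [b])) (app (expand b L d) t')
      have hy' := hy.iterate (b :: (L ++ [b])).length
      rw [e2] at hy'
      have ih := ih (hx.iterate 1) hy'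
      have e1 : shiftMap (app (base b (none :: d)) t) = app (base b d) t := rfl
      rw [List.length_cons, birkhoff_succ, e1, e0, List.length_append, birkhoff_add, app_append, e2]
      have h1 := (abs_le.1 (hφ _ hx)).2
      have h2 := le_birkhoff (fun x hx => (abs_le.1 (hφ x hx)).1) (b :: (L ++ [b])).length hy
      have h3 := hS (lead d + 1)
      have h4 := hW0 0
      simp only [List.length_cons, List.length_append, List.length_nil] at h2 ⊢
      simp only [lead, zero_add, Finset.sum_range_one, List.count_cons_self]
      push_cast at h2 ⊢
      linarith

section Insertion

variable {M : ℕ → ℕ → Prop} {a b k : ℕ} {L : List ℕ} {x : Pt} {d : List (Option ℕ)}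

lemma word_eq_of_mem_PerStarSet (hx : x ∈ PerStarSet M a (k + 1)) :
    word (k + 1) x = a :: word k (shiftMap x) := by
  rw [word, hx.2.2.1]

lemma notMem_word_of_mem_PerStarSet (hx : x ∈ PerStarSet M a (k + 1)) :
    a ∉ word k (shiftMap x) := by
  rw [mem_word]
  rintro ⟨i, hi, h⟩
  exact hx.2.2.2 (i + 1) (by omega) (by omega) h

lemma some_notMem_decs (hx : x ∈ PerStarSet M a (k + 1))
    (hd : d ∈ decs b (word k (shiftMap x))) : some a ∉ d :=
  fun h => notMem_word_of_mem_PerStarSet hx (mem_of_some_mem_decs hd h)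

lemma app_cons_base_eq (hx : x ∈ PerStarSet M a (k + 1))
    (hd : d ∈ decs b (word k (shiftMap x))) : app (base b (some a :: d)) x = x := by
  have h := app_word (k + 1) x
  rw [hx.2.1, word_eq_of_mem_PerStarSet hx, ← base_of_mem_decs hd] at h
  exact h

lemma length_of_mem_decs (hd : d ∈ decs b (word k (shiftMap x))) : d.length = k := by
  have := congrArg List.length (base_of_mem_decs hd)
  simpa [base] using this

lemma per_expand_mem_PerSet (hL : (b :: (L ++ [b])).IsChain M) (hx : x ∈ PerStarSet M a (k + 1))
    (hd : d ∈ decs b (word k (shiftMap x))) :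
    per (a :: expand b L d) ∈ PerSet M a (a :: expand b L d).length := by
  refine ⟨isAdmissible_per (isChain_expand hL d a a ?_), shiftMap_iterate_per _, by simp [per]⟩
  have h := isChain_word hx.1 (k + 2)
  have hk : x (k + 1) = a := by
    have := congrFun hx.2.1 0
    rwa [shiftMap_iterate_apply, Nat.zero_add, hx.2.2.1] at this
  rw [word_succ, word_eq_of_mem_PerStarSet hx, hk, ← base_of_mem_decs hd] at h
  exact h

lemma birkhoff_le_birkhoff_per_expand {φ : Pt → ℝ} {B S : ℝ} {W : ℕ → ℝ}
    (hφ : ∀ x, isAdmissible M x → |φ x| ≤ B) (hW0 : ∀ k, 0 ≤ W k)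
    (hW : ∀ k x y, isAdmissible M x → isAdmissible M y → (∀ i < k, x i = y i) → φ x - φ y ≤ W k)
    (hS : ∀ n, ∑ j ∈ Finset.range n, W j ≤ S)
    (hL : (b :: (L ++ [b])).IsChain M) (hx : x ∈ PerStarSet M a (k + 1))
    (hd : d ∈ decs b (word k (shiftMap x))) :
    birkhoff φ (k + 1) x ≤
      birkhoff φ (a :: expand b L d).length (per (a :: expand b L d)) +
        (d.count none + 1) * (B * (L.length + 3) + S) := by
  have hB : 0 ≤ B := (abs_nonneg _).trans (hφ x hx.1)
  have hp : app (expand b L (some a :: d)) (per (a :: expand b L d)) =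
      per (a :: expand b L d) := app_per _
  have h := birkhoff_base_le hφ hW0 hW hS b L (some a :: d) x (per (a :: expand b L d))
    (by rw [app_cons_base_eq hx hd]; exact hx.1)
    (by rw [hp]; exact (per_expand_mem_PerSet hL hx hd).1)
  rw [app_cons_base_eq hx hd, hp, List.length_cons, length_of_mem_decs hd] at h
  have h2 := hS (lead (some a :: d) + 1)
  simp only [List.count_cons, reduceCtorEq, beq_iff_eq, if_false, add_zero] at h
  simp only [expand] at h
  have : 0 ≤ B * (L.length + 3) := by positivity
  linarith

/-- First-return points at `a` whose word contains at least `δ n` letters `b`. -/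
def manySet (M : ℕ → ℕ → Prop) (a b : ℕ) (δ : ℝ) (n : ℕ) : Set Pt :=
  {x | x ∈ PerStarSet M a n ∧ δ * n ≤ (word n x).count b}

lemma tsum_manySet_mul_le {φ : Pt → ℝ} {B S : ℝ} {W : ℕ → ℝ}
    (hφ : ∀ x, isAdmissible M x → |φ x| ≤ B) (hW0 : ∀ k, 0 ≤ W k)
    (hW : ∀ k x y, isAdmissible M x → isAdmissible M y → (∀ i < k, x i = y i) → φ x - φ y ≤ W k)
    (hS : ∀ n, ∑ j ∈ Finset.range n, W j ≤ S)
    (hL : (b :: (L ++ [b])).IsChain M) (hab : a ≠ b) {u v : List ℕ} (hu : a ∉ u)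
    (hLu : L = u ++ a :: v) {c K s δ κ : ℝ} (hc : c = B * (L.length + 3) + S)
    (hκ : κ = Real.exp (-(c + K * (L.length + 1)))) (hs : s ≤ K) {N : ℕ} (hN : N ≤ k + 1) :
    (∑' x : manySet M a b δ (k + 1),
        ENNReal.ofReal (Real.exp (birkhoff φ (k + 1) x - s * (k + 1 : ℕ)))) *
        ENNReal.ofReal ((1 + κ) ^ (δ * (k + 1 : ℕ))) ≤
      ENNReal.ofReal (Real.exp c) * ∑' p : Σ m, PerSet M a m,
        if N ≤ p.1 then ENNReal.ofReal (Real.exp (birkhoff φ p.1 p.2 - s * p.1)) else 0 := by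
  have hκ0 : 0 < κ := hκ ▸ Real.exp_pos _
  set g : (Σ m, PerSet M a m) → ℝ≥0∞ := fun p =>
    if N ≤ p.1 then ENNReal.ofReal (Real.exp (birkhoff φ p.1 p.2 - s * p.1)) else 0 with hg
  let Φ : (Σ x : manySet M a b δ (k + 1), {d // d ∈ decs b (word k (shiftMap x.1))}) →
      Σ m, PerSet M a m := fun p =>
    ⟨(a :: expand b L p.2.1).length, per (a :: expand b L p.2.1),
      per_expand_mem_PerSet hL p.1.2.1 p.2.2⟩
  have hΦ : Function.Injective Φ := by
    rintro ⟨⟨x, hx⟩, ⟨d, hd⟩⟩ ⟨⟨x', hx'⟩, ⟨d', hd'⟩⟩ h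
    have h1 : word (Φ ⟨⟨x, hx⟩, ⟨d, hd⟩⟩).1 (Φ ⟨⟨x, hx⟩, ⟨d, hd⟩⟩).2.1 =
        word (Φ ⟨⟨x', hx'⟩, ⟨d', hd'⟩⟩).1 (Φ ⟨⟨x', hx'⟩, ⟨d', hd'⟩⟩).2.1 := by rw [h]
    simp only [Φ, word_per, List.cons.injEq, true_and] at h1
    subst hLu
    have h2 := expand_injOn hab hu (some_notMem_decs hx.1 hd) (some_notMem_decs hx'.1 hd') h1
    subst h2
    have h3 : word k (shiftMap x) = word k (shiftMap x') := by
      rw [← base_of_mem_decs hd, ← base_of_mem_decs hd']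
    have h4 : x = x' := by
      have e1 := app_word (k + 1) x
      have e2 := app_word (k + 1) x'
      rw [hx.1.2.1, word_eq_of_mem_PerStarSet hx.1] at e1
      rw [hx'.1.2.1, word_eq_of_mem_PerStarSet hx'.1, ← h3] at e2
      exact eq_of_app_eq (List.cons_ne_nil _ _) e1 e2
    subst h4
    rfl
  have hpt : ∀ (x : manySet M a b δ (k + 1)) (d : {d // d ∈ decs b (word k (shiftMap x.1))}),
      ENNReal.ofReal (Real.exp (birkhoff φ (k + 1) x - s * (k + 1 : ℕ)) *
        κ ^ d.1.count none) ≤ ENNReal.ofReal (Real.exp c) * g (Φ ⟨x, d⟩) := by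
    rintro ⟨x, hx⟩ ⟨d, hd⟩
    have h1 := birkhoff_le_birkhoff_per_expand hφ hW0 hW hS hL hx.1 hd
    have hlen : (a :: expand b L d).length = k + 1 + d.count none * (L.length + 1) := by
      rw [List.length_cons, length_expand, length_of_mem_decs hd]; ring
    simp only [hg, Φ]
    rw [if_pos (by rw [hlen]; omega), ← ENNReal.ofReal_mul (Real.exp_pos _).le]
    refine ENNReal.ofReal_le_ofReal ?_
    rw [hκ, ← Real.exp_nat_mul, ← Real.exp_add, ← Real.exp_add]
    refine Real.exp_le_exp.2 ?_
    rw [← hc] at h1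
    have h2 : ((a :: expand b L d).length : ℝ) = (k + 1 : ℕ) + d.count none * (L.length + 1) := by
      rw [hlen]; push_cast; ring
    rw [h2]
    have h3 : s * (d.count none * (L.length + 1 : ℝ)) ≤ K * (d.count none * (L.length + 1)) :=
      mul_le_mul_of_nonneg_right hs (by positivity)
    linarith
  rw [← ENNReal.tsum_mul_right]
  calc _ ≤ ∑' x : manySet M a b δ (k + 1),
        ∑' d : {d // d ∈ decs b (word k (shiftMap x.1))},
          ENNReal.ofReal (Real.exp c) * g (Φ ⟨x, d⟩) := by
        refine ENNReal.tsum_le_tsum fun x => ?_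
        refine le_trans ?_ (ENNReal.tsum_le_tsum (hpt x))
        rw [Finset.tsum_subtype (decs b (word k (shiftMap x.1))) fun d =>
          ENNReal.ofReal (Real.exp (birkhoff φ (k + 1) x - s * (k + 1 : ℕ)) *
            κ ^ d.count none), ← ENNReal.ofReal_sum_of_nonneg (fun _ _ => by positivity),
          ← Finset.mul_sum, sum_decs, ← ENNReal.ofReal_mul (Real.exp_pos _).le]
        refine ENNReal.ofReal_le_ofReal (mul_le_mul_of_nonneg_left ?_ (Real.exp_pos _).le)
        rw [← Real.rpow_natCast]
        refine Real.rpow_le_rpow_of_exponent_le (by linarith) ?_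
        have := x.2.2
        rwa [word_eq_of_mem_PerStarSet x.2.1, List.count_cons_of_ne hab] at this
    _ = ENNReal.ofReal (Real.exp c) * ∑' p, g (Φ p) := by
        rw [← ENNReal.tsum_sigma (fun x d => ENNReal.ofReal (Real.exp c) * g (Φ ⟨x, d⟩)),
          ENNReal.tsum_mul_left]
    _ ≤ _ := mul_le_mul_right (ENNReal.tsum_comp_le_tsum_of_injective hΦ g) _

end Insertion

/-! ### Exponential growth rates -/

lemma inv_mul_log_le_iff {n : ℕ} (hn : n ≠ 0) (Z : ℝ≥0∞) (s : ℝ) :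
    ((n : ℝ)⁻¹ : EReal) * ENNReal.log Z ≤ (s : EReal) ↔ Z ≤ ENNReal.ofReal (Real.exp (s * n)) := by
  rw [← EReal.div_eq_inv_mul, EReal.div_le_iff_le_mul
    (EReal.coe_pos.2 (by positivity)) (EReal.coe_ne_top _), ← ENNReal.log_le_log_iff,
    ENNReal.log_ofReal_of_pos (Real.exp_pos _), Real.log_exp, ← EReal.coe_mul, mul_comm s]

/-- `Z n` grows at an exponential rate smaller than `P`. -/
def GrowthLT (Z : ℕ → ℝ≥0∞) (P : ℝ) : Prop :=
  ∃ θ < P, ∀ᶠ n : ℕ in atTop, Z n ≤ ENNReal.ofReal (Real.exp (θ * n))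

lemma growthLT_iff {Z : ℕ → ℝ≥0∞} {P : ℝ} :
    GrowthLT Z P ↔
      limsup (fun n : ℕ => ((n : ℝ)⁻¹ : EReal) * ENNReal.log (Z n)) atTop < (P : EReal) := by
  constructor
  · rintro ⟨θ, hθ, h⟩
    refine lt_of_le_of_lt (limsup_le_of_le (a := (θ : EReal)) (h := ?_)) (EReal.coe_lt_coe_iff.2 hθ)
    filter_upwards [h, eventually_ne_atTop 0] with n hn hn0
    exact (inv_mul_log_le_iff hn0 _ _).2 hn
  · intro h
    obtain ⟨θ, h1, h2⟩ := EReal.exists_between_coe_real h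
    refine ⟨θ, EReal.coe_lt_coe_iff.1 h2, ?_⟩
    filter_upwards [eventually_lt_of_limsup_lt h1, eventually_ne_atTop 0] with n hn hn0
    exact (inv_mul_log_le_iff hn0 _ _).1 hn.le

lemma GrowthLT.of_le_mul {Z : ℕ → ℝ≥0∞} {P θ : ℝ} {C : ℝ≥0∞} (hC : C ≠ ⊤) (hθ : θ < P)
    (h : ∀ᶠ n : ℕ in atTop, Z n ≤ C * ENNReal.ofReal (Real.exp (θ * n))) : GrowthLT Z P := by
  obtain ⟨θ', h1, h2⟩ := exists_between hθ
  refine ⟨θ', h2, ?_⟩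
  have ht : Tendsto (fun n : ℕ => Real.exp ((θ' - θ) * n)) atTop atTop :=
    Real.tendsto_exp_atTop.comp
      (tendsto_natCast_atTop_atTop.const_mul_atTop (sub_pos.2 h1))
  filter_upwards [h, ht.eventually_ge_atTop C.toReal] with n hn hn'
  refine hn.trans ?_
  rw [← ENNReal.ofReal_toReal hC, ← ENNReal.ofReal_mul ENNReal.toReal_nonneg]
  refine ENNReal.ofReal_le_ofReal ?_
  calc _ ≤ Real.exp ((θ' - θ) * n) * Real.exp (θ * n) :=
        mul_le_mul_of_nonneg_right hn' (Real.exp_pos _).le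
    _ = _ := by rw [← Real.exp_add]; congr 1; ring

lemma GrowthLT.mono {Z Z' : ℕ → ℝ≥0∞} {P : ℝ} (h : GrowthLT Z P)
    (hle : ∀ᶠ n : ℕ in atTop, Z' n ≤ Z n) : GrowthLT Z' P := by
  obtain ⟨θ, hθ, h⟩ := h
  refine ⟨θ, hθ, ?_⟩
  filter_upwards [h, hle] with n h1 h2 using h2.trans h1

lemma GrowthLT.add {Z Z' : ℕ → ℝ≥0∞} {P : ℝ} (h : GrowthLT Z P) (h' : GrowthLT Z' P) :
    GrowthLT (fun n => Z n + Z' n) P := by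
  obtain ⟨θ, hθ, h⟩ := h
  obtain ⟨θ', hθ', h'⟩ := h'
  refine GrowthLT.of_le_mul (C := 2) (by simp) (max_lt hθ hθ') ?_
  filter_upwards [h, h'] with n h1 h2
  rw [two_mul]
  refine add_le_add (h1.trans ?_) (h2.trans ?_) <;>
    refine ENNReal.ofReal_le_ofReal (Real.exp_le_exp.2
      (mul_le_mul_of_nonneg_right ?_ n.cast_nonneg))
  · exact le_max_left _ _
  · exact le_max_right _ _

lemma GrowthLT.finset_sum {ι : Type*} (s : Finset ι) {Z : ι → ℕ → ℝ≥0∞} {P : ℝ}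
    (h : ∀ i ∈ s, GrowthLT (Z i) P) : GrowthLT (fun n => ∑ i ∈ s, Z i n) P := by
  classical
  induction s using Finset.induction_on with
  | empty => exact ⟨P - 1, by linarith, by simp⟩
  | insert i s hi ih =>
    simp only [Finset.sum_insert hi]
    exact (h i (by simp)).add (ih fun j hj => h j (by simp [hj]))

lemma GrowthLT.exp_mul {Z : ℕ → ℝ≥0∞} {P s : ℝ} (h : GrowthLT Z (P - s)) :
    GrowthLT (fun n => ENNReal.ofReal (Real.exp (n * s)) * Z n) P := by
  obtain ⟨θ, hθ, h⟩ := h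
  refine ⟨θ + s, by linarith, ?_⟩
  filter_upwards [h] with n hn
  refine (mul_le_mul_right hn _).trans ?_
  rw [← ENNReal.ofReal_mul (Real.exp_pos _).le, ← Real.exp_add]
  exact ENNReal.ofReal_le_ofReal (Real.exp_le_exp.2 (by linarith))

/-! ### First-return points visiting a finite set often, resp. rarely -/

lemma exists_loop {M : ℕ → ℕ → Prop} (htrans : TopTransitive M) {a b : ℕ} (hab : a ≠ b) :
    ∃ u v : List ℕ, a ∉ u ∧ (b :: ((u ++ a :: v) ++ [b])).IsChain M := by
  classical
  obtain ⟨N, x, hx, hx0, hxN⟩ := htrans b a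
  obtain ⟨N', y, hy, hy0, hyN⟩ := htrans a b
  have hex : ∃ k, x k = a := ⟨N, hxN⟩
  obtain ⟨k, hk⟩ : ∃ k, Nat.find hex = k + 1 := Nat.exists_eq_succ_of_ne_zero fun h => by
    have := Nat.find_spec hex
    rw [h, hx0] at this
    exact hab this.symm
  obtain ⟨m, rfl⟩ : ∃ m, N' = m + 1 := Nat.exists_eq_succ_of_ne_zero fun h => by
    rw [h, hy0] at hyN
    exact hab hyN
  refine ⟨word k (shiftMap x), word m (shiftMap y), ?_, ?_⟩
  · rw [mem_word]
    rintro ⟨i, hi, h⟩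
    exact Nat.find_min hex (m := i + 1) (by omega) h
  · have h1 := isChain_word hx (k + 2)
    have h2 := isChain_word hy (m + 2)
    have hxk : x (k + 1) = a := hk ▸ Nat.find_spec hex
    rw [word_succ, word, hx0, hxk] at h1
    rw [word_succ, word, hy0, hyN] at h2
    have := List.isChain_split (R := M) (c := a) (l₁ := b :: word k (shiftMap x))
      (l₂ := word m (shiftMap y) ++ [b])
    simpa using this.2 ⟨h1, h2⟩

lemma SummableVariations.exists_bound {M : ℕ → ℕ → Prop} {φ : Pt → ℝ}
    (h : SummableVariations M φ) {B : ℝ} (hB : 0 ≤ B) (hφ : ∀ x, isAdmissible M x → |φ x| ≤ B) :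
    ∃ (W : ℕ → ℝ) (S : ℝ), (∀ k, 0 ≤ W k) ∧ (∀ k x y, isAdmissible M x → isAdmissible M y →
      (∀ i < k, x i = y i) → φ x - φ y ≤ W k) ∧ ∀ n, ∑ j ∈ Finset.range n, W j ≤ S := by
  obtain ⟨V, hV, hvar⟩ := h
  have hW0 : ∀ k, 0 ≤ |V k| + if k < 2 then 2 * B else 0 := fun k => by positivity
  have hsum : Summable fun k => |V k| + if k < 2 then 2 * B else 0 :=
    hV.abs.add (summable_of_ne_finset_zero (s := Finset.range 2) fun k hk => by
      rw [if_neg (by simpa using hk)])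
  refine ⟨_, _, hW0, fun k x y hx hy hxy => ?_, fun n => hsum.sum_le_tsum _ fun k _ => hW0 k⟩
  split_ifs with hk
  · have h1 := abs_le.1 (hφ x hx)
    have h2 := abs_le.1 (hφ y hy)
    have h3 := abs_nonneg (V k)
    linarith
  · have h1 := (le_abs_self _).trans (hvar k (by omega) x y hx hy hxy)
    have h2 := le_abs_self (V k)
    linarith

lemma growthLT_manySet {M : ℕ → ℕ → Prop} {φ : Pt → ℝ} (htrans : TopTransitive M)
    (hsum : SummableVariations M φ) {B : ℝ} (hφ : ∀ x, isAdmissible M x → |φ x| ≤ B)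
    (hB : 0 ≤ B) {a b : ℕ} (hab : a ≠ b) {P : ℝ} (hP : pressureAt M φ a = (P : EReal)) {δ : ℝ}
    (hδ : 0 < δ) :
    GrowthLT (fun n => ∑' x : manySet M a b δ n, ENNReal.ofReal (Real.exp (birkhoff φ n x))) P := by
  obtain ⟨u, v, hu, hL⟩ := exists_loop htrans hab
  obtain ⟨W, S, hW0, hW, hS⟩ := hsum.exists_bound hB hφ
  set L := u ++ a :: v with hLu
  set c := B * (L.length + 3) + S with hc
  set κ := Real.exp (-(c + (|P| + 1) * (L.length + 1))) with hκ
  have hκ0 : 0 < κ := Real.exp_pos _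
  set r := δ * Real.log (1 + κ) with hr
  have hr0 : 0 < r := mul_pos hδ (Real.log_pos (by linarith))
  set s := P + min 1 (r / 2) with hs
  have hsP : P < s := by
    have : 0 < min 1 (r / 2) := lt_min one_pos (by linarith)
    linarith
  have hsK : s ≤ |P| + 1 := by
    have h1 := le_abs_self P
    have h2 := min_le_left 1 (r / 2)
    linarith
  have hsr : s - r < P := by
    have := min_le_right 1 (r / 2)
    linarith
  obtain ⟨θ, hθs, hθ⟩ := growthLT_iff.2 (hP.trans_lt (EReal.coe_lt_coe_iff.2 hsP))
  obtain ⟨N, hN⟩ := eventually_atTop.1 hθ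
  have hG : (∑' p : Σ m, PerSet M a m, if N ≤ p.1 then
      ENNReal.ofReal (Real.exp (birkhoff φ p.1 p.2 - s * p.1)) else 0) ≠ ⊤ := by
    rw [ENNReal.tsum_sigma (fun (m : ℕ) (x : PerSet M a m) => if N ≤ m then
      ENNReal.ofReal (Real.exp (birkhoff φ m x - s * m)) else 0)]
    have hgeo : Summable fun m : ℕ => Real.exp ((θ - s) * m) := by
      simpa [mul_comm] using
        Real.summable_exp_nat_mul_iff.2 (sub_neg.2 hθs)
    refine ne_top_of_le_ne_top hgeo.tsum_ofReal_ne_top (ENNReal.tsum_le_tsum fun m => ?_)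
    by_cases hm : N ≤ m
    · simp only [hm, if_true]
      calc _ = ∑' x : PerSet M a m, ENNReal.ofReal (Real.exp (birkhoff φ m x)) *
            ENNReal.ofReal (Real.exp (-(s * m))) := by
            refine tsum_congr fun x => ?_
            rw [← ENNReal.ofReal_mul (Real.exp_pos _).le, ← Real.exp_add, sub_eq_add_neg]
        _ = Zn M φ a m * ENNReal.ofReal (Real.exp (-(s * m))) := ENNReal.tsum_mul_right
        _ ≤ _ := mul_le_mul_left (hN m hm) _
        _ = _ := by
            rw [← ENNReal.ofReal_mul (Real.exp_pos _).le, ← Real.exp_add]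
            congr 2; ring
    · simp [hm]
  refine GrowthLT.of_le_mul (ENNReal.mul_ne_top ENNReal.ofReal_ne_top hG) hsr
    (C := ENNReal.ofReal (Real.exp c) * _) ?_
  filter_upwards [eventually_ge_atTop (N + 1)] with n hn
  obtain ⟨k, rfl⟩ : ∃ k, n = k + 1 := ⟨n - 1, by omega⟩
  have h := tsum_manySet_mul_le (δ := δ) hφ hW0 hW hS hL hab hu hLu hc hκ hsK
    (show N ≤ k + 1 by omega)
  refine le_trans (le_of_eq ?_) (mul_le_mul_left h
    (ENNReal.ofReal (Real.exp ((s - r) * (k + 1 : ℕ)))))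
  rw [← ENNReal.tsum_mul_right, ← ENNReal.tsum_mul_right]
  refine tsum_congr fun x => ?_
  rw [← ENNReal.ofReal_mul (Real.exp_pos _).le, ← ENNReal.ofReal_mul (by positivity),
    Real.rpow_def_of_pos (by linarith), ← Real.exp_add, ← Real.exp_add]
  congr 2
  rw [hr]; ring

/-- First-return points at `a` that visit `{0, …, q}` rarely. -/
def fewSet (M : ℕ → ℕ → Prop) (a M' q n : ℕ) : Set Pt :=
  {x | x ∈ PerStarSet M a n ∧
    (((Finset.range (n + 1)).filter (fun k => x k ≤ q)).card : ℝ) ≤ (n + 1 : ℝ) / (M' : ℝ)}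

lemma tsum_fewSet_le {M : ℕ → ℕ → Prop} {φ : Pt → ℝ} {s : ℝ}
    (hs : ∀ x, isAdmissible M x → φ x ≤ s) {a M' q n : ℕ} (haq : a ≤ q) (hn : n ≠ 0) :
    ∑' x : fewSet M a M' q n, ENNReal.ofReal (Real.exp (birkhoff φ n x)) ≤
      ENNReal.ofReal (Real.exp (n * s)) * zCount M n M' q := by
  have hper : ∀ x : fewSet M a M' q n, x.1 n = a := fun x => by
    have := congrFun x.2.1.2.1 0
    rwa [shiftMap_iterate_apply, Nat.zero_add, x.2.1.2.2.1] at this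
  calc _ ≤ ∑' _x : fewSet M a M' q n, ENNReal.ofReal (Real.exp (n * s)) * 1 := by
        refine ENNReal.tsum_le_tsum fun x => ?_
        rw [mul_one]
        exact ENNReal.ofReal_le_ofReal (Real.exp_le_exp.2 (birkhoff_le hs n x.2.1.1))
    _ = ENNReal.ofReal (Real.exp (n * s)) * ∑' _x : fewSet M a M' q n, 1 := ENNReal.tsum_mul_left
    _ ≤ _ := by
        refine mul_le_mul_right ?_ _
        refine ENNReal.tsum_comp_le_tsum_of_injective
          (f := fun x : fewSet M a M' q n => (⟨fun i : Fin (n + 1) => x.1 i,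
            ⟨x.1, x.2.1.1, fun _ => rfl⟩, ?_, ?_, ?_⟩ : {w : Fin (n + 1) → ℕ //
      (∃ x : Pt, isAdmissible M x ∧ ∀ i : Fin (n + 1), x (i : ℕ) = w i) ∧
      w 0 ≤ q ∧ w (Fin.last n) ≤ q ∧
      (((Finset.univ.filter (fun i : Fin (n + 1) => w i ≤ q)).card : ℝ) ≤
        (n + 1 : ℝ) / (M' : ℝ))})) ?_ (fun _ => 1)
        · simpa [x.2.1.2.2.1] using haq
        · simpa [hper x] using haq
        · have h := x.2.2
          rw [Finset.card_filter] at h ⊢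
          rwa [Fin.sum_univ_eq_sum_range (fun k => if x.1 k ≤ q then 1 else 0)]
        · intro x y hxy
          simp only [Subtype.mk.injEq] at hxy
          refine Subtype.ext ?_
          have hw : word n x.1 = word n y.1 := by
            have key : ∀ m ≤ n, word m x.1 = word m y.1 := by
              intro m
              induction m with
              | zero => exact fun _ => rfl
              | succ m ih =>
                intro hm
                rw [word_succ, word_succ, ih (by omega)]
                have := congrFun hxy ⟨m, by omega⟩
                simp only at this
                rw [this]
            exact key n le_rfl
          have e1 := app_word n x.1
          have e2 := app_word n y.1
          rw [x.2.1.2.1] at e1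
          rw [y.2.1.2.1, ← hw] at e2
          refine eq_of_app_eq (fun h => hn ?_) e1 e2
          rw [← length_word n x.1, h]; rfl

lemma PerStarSet_subset {M : ℕ → ℕ → Prop} {M' q n : ℕ} (hM' : 0 < M') (hn : 4 * M' ≤ n) :
    PerStarSet M 0 n ⊆ fewSet M 0 M' q n ∪
      ⋃ b ∈ Finset.Icc 1 q, manySet M 0 b (1 / (2 * M' * (q + 1))) n := by
  intro x hx
  by_contra hcon
  simp only [Set.mem_union, Set.mem_iUnion, not_or, not_exists] at hcon
  obtain ⟨h1, h2⟩ := hcon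
  have h1 : (n + 1 : ℝ) / M' < ((Finset.range (n + 1)).filter (fun k => x k ≤ q)).card :=
    lt_of_not_ge fun h => h1 ⟨hx, h⟩
  have h2 : ∀ b ∈ Finset.Icc 1 q, (((Finset.range n).filter (fun k => x k = b)).card : ℝ) ≤
      1 / (2 * M' * (q + 1)) * n := fun b hb => by
    rw [← count_word]
    exact (lt_of_not_ge fun h => h2 b hb ⟨hx, h⟩).le
  have hsub : (Finset.range (n + 1)).filter (fun k => x k ≤ q) ⊆
      {0, n} ∪ (Finset.Icc 1 q).biUnion fun b => (Finset.range n).filter (fun k => x k = b) := by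
    intro k hk
    simp only [Finset.mem_filter, Finset.mem_range, Finset.mem_union, Finset.mem_insert,
      Finset.mem_singleton, Finset.mem_biUnion, Finset.mem_Icc] at hk ⊢
    by_cases h : k = 0 ∨ k = n
    · exact Or.inl h
    · have := hx.2.2.2 k (by omega) (by omega)
      exact Or.inr ⟨x k, ⟨by omega, hk.2⟩, by omega, rfl⟩
  have h3 : (((Finset.range (n + 1)).filter (fun k => x k ≤ q)).card : ℝ) ≤
      2 + q * (1 / (2 * M' * (q + 1)) * n) := by
    have e1 := (Finset.card_le_card hsub).trans (Finset.card_union_le _ _)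
    have e2 : ({0, n} : Finset ℕ).card ≤ 2 := Finset.card_le_two
    have e3 : (((Finset.Icc 1 q).biUnion fun b =>
        (Finset.range n).filter (fun k => x k = b)).card : ℝ) ≤
        q * (1 / (2 * M' * (q + 1)) * n) := by
      refine le_trans (Nat.cast_le.2 Finset.card_biUnion_le) ?_
      push_cast
      refine (Finset.sum_le_card_nsmul _ _ _ h2).trans (le_of_eq ?_)
      simp
    have e4 : (((Finset.range (n + 1)).filter (fun k => x k ≤ q)).card : ℝ) ≤
      ({0, n} : Finset ℕ).card + ((Finset.Icc 1 q).biUnion fun b =>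
        (Finset.range n).filter (fun k => x k = b)).card := by exact_mod_cast e1
    have e5 : (({0, n} : Finset ℕ).card : ℝ) ≤ 2 := by exact_mod_cast e2
    linarith
  have hM : (0 : ℝ) < M' := Nat.cast_pos.2 hM'
  have hn' : (4 * M' : ℝ) ≤ n := by exact_mod_cast hn
  have h4 : (q : ℝ) * (1 / (2 * M' * (q + 1)) * n) ≤ n / (2 * M') := by
    have : (q : ℝ) * (1 / (2 * M' * (q + 1)) * n) = n / (2 * M') * (q / (q + 1)) := by
      field_simp
    rw [this]
    refine mul_le_of_le_one_right (by positivity) ?_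
    rw [div_le_one (by positivity)]; linarith
  have h5 : (n + 1 : ℝ) / M' < 2 + n / (2 * M') := by linarith
  have h6 : 2 + (n : ℝ) / (2 * M') ≤ (n + 1) / M' := by
    rw [le_div_iff₀ hM]
    have : (2 + (n : ℝ) / (2 * M')) * M' = 2 * M' + n / 2 := by field_simp
    rw [this]; linarith
  linarith

/-- If the growth of the words rarely visiting a finite set, weighted with `sup φ`, is smaller
than the pressure, then `φ` is strongly positive recurrent. -/
lemma SPR_of_hInfty_lt {M : ℕ → ℕ → Prop} {φ : Pt → ℝ} (htrans : TopTransitive M)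
    (hsum : SummableVariations M φ) {B : ℝ} (hφ : ∀ x, isAdmissible M x → |φ x| ≤ B)
    (hB : 0 ≤ B) {s : ℝ} (hs : ∀ x, isAdmissible M x → φ x ≤ s) {P : ℝ}
    (hP : pressureAt M φ 0 = (P : EReal)) (h : hInfty M < ((P - s : ℝ) : EReal)) :
    SPR M φ P := by
  obtain ⟨q, hq⟩ := (frequently_lt_of_liminf_lt (h := h)).exists
  obtain ⟨M', hM', hM0⟩ :=
    ((frequently_lt_of_liminf_lt (h := hq)).and_eventually (eventually_gt_atTop 0)).exists
  refine ⟨0, growthLT_iff.1 (GrowthLT.mono (GrowthLT.add (growthLT_iff.2 hM').exp_mul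
    (GrowthLT.finset_sum (Finset.Icc 1 q) fun b hb => growthLT_manySet htrans hsum hφ hB
      (show 0 ≠ b by have := (Finset.mem_Icc.1 hb).1; omega) hP
      (δ := 1 / (2 * M' * (q + 1))) (by positivity))) ?_)⟩
  filter_upwards [eventually_ge_atTop (4 * M')] with n hn
  let f : Pt → ℝ≥0∞ := fun x => ENNReal.ofReal (Real.exp (birkhoff φ n x))
  refine (ENNReal.tsum_mono_subtype f (PerStarSet_subset (q := q) hM0 hn)).trans ?_
  refine (ENNReal.tsum_union_le f _ _).trans (add_le_add ?_ (ENNReal.tsum_biUnion_le f _ _))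
  exact tsum_fewSet_le hs (Nat.zero_le q) (by omega)

/-! ### Comparison of `δ_{φ,∞}`, `h_∞` and the pressures -/

lemma add_le_pressure {M : ℕ → ℕ → Prop} {φ : Pt → ℝ} {i H P : ℝ} {a : ℕ}
    (hi : ∀ x, isAdmissible M x → i ≤ φ x)
    (hH : pressureAt M (fun _ => (0 : ℝ)) a = (H : EReal))
    (hP : pressureAt M φ a = (P : EReal)) : H + i ≤ P := by
  by_contra! hcon
  have h1 : GrowthLT (Zn M φ a) (H - -i) :=
    growthLT_iff.2 (hP.trans_lt (EReal.coe_lt_coe_iff.2 (by linarith)))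
  have h2 : GrowthLT (Zn M (fun _ => (0 : ℝ)) a) H := by
    refine h1.exp_mul.mono (Eventually.of_forall fun n => ?_)
    rw [Zn, Zn, ← ENNReal.tsum_mul_left]
    refine ENNReal.tsum_le_tsum fun x => ?_
    rw [← ENNReal.ofReal_mul (Real.exp_pos _).le, ← Real.exp_add]
    refine ENNReal.ofReal_le_ofReal (Real.exp_le_exp.2 ?_)
    have := le_birkhoff hi n x.2.1
    simp only [birkhoff, Finset.sum_const_zero] at this ⊢
    linarith
  exact lt_irrefl _ (hH ▸ growthLT_iff.1 h2)

lemma deltaInf_le {M : ℕ → ℕ → Prop} {φ : Pt → ℝ} {s : ℝ}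
    (hs : ∀ x, isAdmissible M x → φ x ≤ s) : deltaInf M φ ≤ (s : EReal) := by
  refine liminf_le_of_frequently_le' (Frequently.of_forall fun q => ?_)
  refine liminf_le_of_frequently_le' (Frequently.of_forall fun M' => ?_)
  refine limsup_le_of_le (h := ?_)
  filter_upwards [eventually_gt_atTop 0] with n hn
  refine iSup_le fun x => EReal.coe_le_coe_iff.2 ?_
  rw [div_le_iff₀ (by exact_mod_cast hn), mul_comm]
  exact birkhoff_le hs n x.2.1

lemma deltaInf_eq_bot_of_hInfty_neg {M : ℕ → ℕ → Prop} (φ : Pt → ℝ) (h : hInfty M < 0) :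
    deltaInf M φ = ⊥ := by
  refine le_bot_iff.1 (liminf_le_of_frequently_le' ?_)
  refine (frequently_lt_of_liminf_lt (h := h)).mono fun q hq => ?_
  refine liminf_le_of_frequently_le' ?_
  refine (frequently_lt_of_liminf_lt (h := hq)).mono fun M' hM' => ?_
  refine limsup_le_of_le (h := ?_)
  filter_upwards [eventually_lt_of_limsup_lt hM'] with n hn
  refine iSup_le fun x => absurd hn (not_lt.2 ?_)
  refine mul_nonneg (EReal.inv_nonneg_of_nonneg (EReal.coe_nonneg.2 n.cast_nonneg))
    (ENNReal.zero_le_log_iff.2 ?_)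
  refine ENNReal.le_tsum (f := fun _ => (1 : ℝ≥0∞)) ⟨fun i : Fin (n + 1) => x.1 i,
    ⟨x.1, x.2.1, fun _ => rfl⟩, x.2.2.1, x.2.2.2.1, ?_⟩
  have h := x.2.2.2.2
  rw [Finset.card_filter] at h ⊢
  rwa [Fin.sum_univ_eq_sum_range (fun k => if x.1 k ≤ q then 1 else 0)]

end CMS

/-- SPR from a bounded range condition.
Let `(Σ,σ)` be a topologically transitive countable Markov shift with finite
topological entropy `h_top = H < ∞` and `φ : Σ → ℝ` a bounded potential with
summable variations, with Gurevich pressure `P = P(φ)`.  If `h_∞ < h_top` and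
`sup φ - inf φ < h_top - h_∞`, then `δ_{φ,∞} + h_∞ < P(φ)`; in particular
`δ_{φ,∞} < P(φ)` (condition (CI)) and `φ` is strongly positive recurrent. -/
theorem bounded_range_implies_SPR
    (M : ℕ → ℕ → Prop) (φ : Pt → ℝ)
    (htrans : TopTransitive M)
    (H : ℝ) (hH : ∀ a : ℕ, pressureAt M (fun _ => (0 : ℝ)) a = (H : EReal))
    (hsum : SummableVariations M φ)
    (hbdd : ∃ b : ℝ, ∀ x : Pt, isAdmissible M x → |φ x| ≤ b)
    (P : ℝ) (hP : ∀ a : ℕ, pressureAt M φ a = (P : EReal))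
    (hinf_lt : hInfty M < (H : EReal))
    (hrange : ((sSup (φ '' {x : Pt | isAdmissible M x}) -
        sInf (φ '' {x : Pt | isAdmissible M x}) : ℝ) : EReal) < (H : EReal) - hInfty M) :
    deltaInf M φ + hInfty M < (P : EReal) ∧
      deltaInf M φ < (P : EReal) ∧ SPR M φ P := by
  obtain ⟨B, hB⟩ := hbdd
  obtain ⟨-, x₀, hx₀, -⟩ := htrans 0 0
  have hB0 : 0 ≤ B := (abs_nonneg _).trans (hB x₀ hx₀)
  set s := sSup (φ '' {x : Pt | isAdmissible M x})
  set i := sInf (φ '' {x : Pt | isAdmissible M x})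
  have hs : ∀ x, isAdmissible M x → φ x ≤ s := fun x hx =>
    le_csSup ⟨B, by rintro _ ⟨y, hy, rfl⟩; exact (abs_le.1 (hB y hy)).2⟩ ⟨x, hx, rfl⟩
  have hi : ∀ x, isAdmissible M x → i ≤ φ x := fun x hx =>
    csInf_le ⟨-B, by rintro _ ⟨y, hy, rfl⟩; exact (abs_le.1 (hB y hy)).1⟩ ⟨x, hx, rfl⟩
  have hHP : H + i ≤ P := add_le_pressure hi (hH 0) (hP 0)
  have hδ := deltaInf_le hs
  have hlt : hInfty M < ((P - s : ℝ) : EReal) := by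
    induction hh : hInfty M with
    | bot => exact EReal.bot_lt_coe _
    | top => simp [hh] at hinf_lt
    | coe r =>
      rw [hh, ← EReal.coe_sub, EReal.coe_lt_coe_iff] at hrange
      exact EReal.coe_lt_coe_iff.2 (by linarith)
  have hadd : deltaInf M φ + hInfty M < (P : EReal) := by
    induction hh : hInfty M with
    | bot => simp
    | top => simp [hh] at hinf_lt
    | coe r =>
      rw [hh, EReal.coe_lt_coe_iff] at hlt
      refine (add_le_add_left hδ _).trans_lt ?_
      rw [← EReal.coe_add, EReal.coe_lt_coe_iff]
      linarith
  refine ⟨hadd, ?_, SPR_of_hInfty_lt htrans hsum hB hB0 hs (hP 0) hlt⟩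
  rcases lt_or_ge (hInfty M) 0 with h | h
  · rw [deltaInf_eq_bot_of_hInfty_neg φ h]
    exact EReal.bot_lt_coe _
  · exact (le_add_of_nonneg_right h).trans_lt hadd
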